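/- arXiv:1907.12043 — 2 statements merged into one kernel-verified Lean document; each statement's English description precedes it below -/
import Mathlib

section
/- Every non-trivial monotone increasing graph property has a threshold in the binomial random motif graph G(H,n,p). That is, for every such property P there exists a function p* = p*(n) such that Pr[G(H,n,p) ∈ P] → 0 as n → ∞ whenever p/p* → 0, and Pr[G(H,n,p) ∈ P] → 1 as n → ∞ whenever p/p* → ∞. -/
open Filter

namespace RandomMotif

/-- `G` is a *copy* of `H` in the complete graph on `Fin n`: the image of `H`
under an injection of its vertices into `Fin n`. -/
def IsCopy {k n : ℕ} (H : SimpleGraph (Fin k)) (G : SimpleGraph (Fin n)) : Prop :=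
  ∃ f : Fin k ↪ Fin n, G = H.map f

/-- The type of copies of `H` in `K_n`. -/
abbrev Copy {k : ℕ} (H : SimpleGraph (Fin k)) (n : ℕ) : Type :=
  {G : SimpleGraph (Fin n) // IsCopy H G}

/-- The graph spanned by the selected copies. -/
noncomputable def graphOf {k n : ℕ} {H : SimpleGraph (Fin k)} (ω : Copy H n → Bool) :
    SimpleGraph (Fin n) :=
  ⨆ c : Copy H n, if ω c then c.1 else ⊥

open Classical in
/-- The probability, in the binomial random motif model `G(H,n,p)` (each copy of `H`
in `K_n` is included independently with probability `p`), of the event `P` on the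
family of selected copies. -/
noncomputable def selProb {k : ℕ} (H : SimpleGraph (Fin k)) (n : ℕ) (p : ℝ)
    (P : (Copy H n → Bool) → Prop) : ℝ :=
  ∑ ω : Copy H n → Bool,
    (∏ c : Copy H n, if ω c then p else 1 - p) * (if P ω then 1 else 0)

/-- The probability that `G(H,n,p)` satisfies the graph predicate `Q`. -/
noncomputable def motifProb {k : ℕ} (H : SimpleGraph (Fin k)) (n : ℕ) (p : ℝ)
    (Q : SimpleGraph (Fin n) → Prop) : ℝ :=
  selProb H n p (fun ω => Q (graphOf ω))

/-- `mr H n r` is the number of copies of `H` in `K_n` whose vertex set meets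
`[r] = {0,…,r-1}`. -/
noncomputable def mr {k : ℕ} (H : SimpleGraph (Fin k)) (n r : ℕ) : ℕ :=
  Nat.card {G : SimpleGraph (Fin n) // IsCopy H G ∧ ∃ v ∈ G.support, (v : ℕ) < r}

/-- The minimum degree `δ(H)`. -/
noncomputable def minDeg {k : ℕ} (H : SimpleGraph (Fin k)) : ℕ :=
  ⨅ v, (H.neighborSet v).ncard

/-- `δ_d(H) = ⌈d / δ(H)⌉ - 1`. -/
noncomputable def deltad {k : ℕ} (H : SimpleGraph (Fin k)) (d : ℕ) : ℕ :=
  ⌈(d : ℝ) / (minDeg H : ℝ)⌉₊ - 1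

/-- `p_d^-(H) = (ln n + δ_d(H) ln ln n - x(n)) / m_1(H)`, where `x` is a fixed
function with `1 ≪ x(n) ≪ ln ln n`. -/
noncomputable def pMinus {k : ℕ} (H : SimpleGraph (Fin k)) (d : ℕ) (x : ℕ → ℝ) (n : ℕ) : ℝ :=
  (Real.log n + (deltad H d) * Real.log (Real.log n) - x n) / (mr H n 1)

/-- `p_d^+(H) = (ln n + δ_d(H) ln ln n + x(n)) / m_1(H)`, where `x` is a fixed
function with `1 ≪ x(n) ≪ ln ln n`. -/
noncomputable def pPlus {k : ℕ} (H : SimpleGraph (Fin k)) (d : ℕ) (x : ℕ → ℝ) (n : ℕ) : ℝ :=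
  (Real.log n + (deltad H d) * Real.log (Real.log n) + x n) / (mr H n 1)

section BernoulliProduct

variable {ι : Type*} [Fintype ι]

/-- The probability of the outcome `ω` of independent Bernoulli variables of parameter `p`. -/
noncomputable def bernoulliWeight (p : ℝ) (ω : ι → Bool) : ℝ :=
  ∏ c, if ω c then p else 1 - p

lemma bernoulliWeight_nonneg {p : ℝ} (hp : p ∈ Set.Icc (0 : ℝ) 1) (ω : ι → Bool) :
    0 ≤ bernoulliWeight p ω := by
  refine Finset.prod_nonneg fun c _ => ?_
  split_ifs
  · exact hp.1
  · linarith [hp.2]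

variable [DecidableEq ι]

open Classical in
/-- The probability of the event `A` for independent Bernoulli variables of parameter `p`. -/
noncomputable def bernoulliProb (p : ℝ) (A : (ι → Bool) → Prop) : ℝ :=
  ∑ ω : ι → Bool, bernoulliWeight p ω * (if A ω then 1 else 0)

lemma sum_bernoulliWeight (p : ℝ) : ∑ ω : ι → Bool, bernoulliWeight p ω = 1 := by
  unfold bernoulliWeight
  rw [← Fintype.prod_sum (fun (_ : ι) (b : Bool) => if b then p else 1 - p)]
  simp

lemma bernoulliProb_nonneg {p : ℝ} (hp : p ∈ Set.Icc (0 : ℝ) 1) (A : (ι → Bool) → Prop) :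
    0 ≤ bernoulliProb p A :=
  Finset.sum_nonneg fun ω _ =>
    mul_nonneg (bernoulliWeight_nonneg hp ω) (by split_ifs <;> norm_num)

lemma bernoulliProb_add_not (p : ℝ) (A : (ι → Bool) → Prop) :
    bernoulliProb p A + bernoulliProb p (fun ω => ¬ A ω) = 1 := by
  rw [← sum_bernoulliWeight (ι := ι) p, bernoulliProb, bernoulliProb, ← Finset.sum_add_distrib]
  refine Finset.sum_congr rfl fun ω _ => ?_
  by_cases h : A ω <;> simp [h]

lemma bernoulliProb_le_one {p : ℝ} (hp : p ∈ Set.Icc (0 : ℝ) 1) (A : (ι → Bool) → Prop) :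
    bernoulliProb p A ≤ 1 := by
  linarith [bernoulliProb_add_not p A, bernoulliProb_nonneg hp (fun ω => ¬ A ω)]

lemma continuous_bernoulliProb (A : (ι → Bool) → Prop) :
    Continuous fun p : ℝ => bernoulliProb p A := by
  unfold bernoulliProb bernoulliWeight
  refine continuous_finsetSum _ fun ω _ => Continuous.mul ?_ continuous_const
  refine continuous_finsetProd _ fun c _ => ?_
  split_ifs <;> fun_prop

lemma bernoulliProb_zero {A : (ι → Bool) → Prop} (hA : ¬ A fun _ => false) :
    bernoulliProb 0 A = 0 := by
  refine Finset.sum_eq_zero fun ω _ => ?_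
  by_cases h : A ω
  · obtain ⟨c, hc⟩ : ∃ c, ω c = true := by
      by_contra! hne
      exact hA ((funext fun c => by simpa using hne c : ω = fun _ => false) ▸ h)
    rw [bernoulliWeight, Finset.prod_eq_zero (Finset.mem_univ c) (by simp [hc]), zero_mul]
  · simp [h]

lemma bernoulliProb_one {A : (ι → Bool) → Prop} (hA : A fun _ => true) :
    bernoulliProb 1 A = 1 := by
  have h : bernoulliProb 1 (fun ω => ¬ A ω) = 0 := by
    refine Finset.sum_eq_zero fun ω _ => ?_
    by_cases h : A ω
    · simp [h]
    · obtain ⟨c, hc⟩ : ∃ c, ω c = false := by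
        by_contra! hne
        exact h ((funext fun c => by simpa using hne c : ω = fun _ => true) ▸ hA)
      rw [bernoulliWeight, Finset.prod_eq_zero (Finset.mem_univ c) (by simp [hc]), zero_mul]
  linarith [bernoulliProb_add_not 1 A]

/-- The union of two independent samples is a sample with the complementary
probabilities multiplied. -/
lemma sum_bernoulliWeight_mul_or (p q : ℝ) (F : (ι → Bool) → ℝ) :
    ∑ ω, bernoulliWeight (1 - (1 - p) * (1 - q)) ω * F ω =
      ∑ ω : ι → Bool, ∑ η : ι → Bool,
        bernoulliWeight p ω * bernoulliWeight q η * F (fun c => ω c || η c) := by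
  let w : ℝ → Bool → ℝ := fun r b => if b then r else 1 - r
  have hweight (ζ : ι → Bool) : bernoulliWeight (1 - (1 - p) * (1 - q)) ζ =
      ∑ x : ι → Bool × Bool with (fun c => (x c).1 || (x c).2) = ζ,
        ∏ c, w p (x c).1 * w q (x c).2 := by
    have hfiber : (Finset.univ.filter fun x : ι → Bool × Bool =>
        (fun c => (x c).1 || (x c).2) = ζ) =
        Fintype.piFinset fun c =>
          Finset.univ.filter fun y : Bool × Bool => (y.1 || y.2) = ζ c := by
      ext x
      simp [funext_iff, Fintype.mem_piFinset]
    rw [hfiber, ← Finset.prod_univ_sum (fun c => Finset.univ.filter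
      fun y : Bool × Bool => (y.1 || y.2) = ζ c) (fun _ y => w p y.1 * w q y.2)]
    refine Finset.prod_congr rfl fun c _ => ?_
    rw [Finset.sum_filter, Fintype.sum_prod_type]
    cases ζ c <;> simp [w]
    ring
  calc ∑ ζ, bernoulliWeight (1 - (1 - p) * (1 - q)) ζ * F ζ
      = ∑ ζ, ∑ x : ι → Bool × Bool with (fun c => (x c).1 || (x c).2) = ζ,
          (∏ c, w p (x c).1 * w q (x c).2) * F (fun c => (x c).1 || (x c).2) := by
        refine Finset.sum_congr rfl fun ζ _ => ?_
        rw [hweight, Finset.sum_mul]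
        refine Finset.sum_congr rfl fun x hx => ?_
        rw [(Finset.mem_filter.1 hx).2]
    _ = ∑ x : ι → Bool × Bool,
          (∏ c, w p (x c).1 * w q (x c).2) * F (fun c => (x c).1 || (x c).2) :=
        Finset.sum_fiberwise _ _ _
    _ = ∑ z : (ι → Bool) × (ι → Bool),
          bernoulliWeight p z.1 * bernoulliWeight q z.2 * F (fun c => z.1 c || z.2 c) := by
        refine Fintype.sum_equiv (Equiv.arrowProdEquivProdArrow ι (fun _ => Bool) (fun _ => Bool))
          _ _ fun x => ?_
        rw [Finset.prod_mul_distrib]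
        rfl
    _ = _ := Fintype.sum_prod_type _

variable {A : (ι → Bool) → Prop}

lemma one_sub_bernoulliProb_union_le (hA : Monotone A) {p q : ℝ}
    (hp : p ∈ Set.Icc (0 : ℝ) 1) (hq : q ∈ Set.Icc (0 : ℝ) 1) :
    1 - bernoulliProb (1 - (1 - p) * (1 - q)) A ≤
      (1 - bernoulliProb p A) * (1 - bernoulliProb q A) := by
  have hnot (r : ℝ) : 1 - bernoulliProb r A = bernoulliProb r (fun ω => ¬ A ω) := by
    linarith [bernoulliProb_add_not r A]
  rw [hnot, hnot, hnot, bernoulliProb, sum_bernoulliWeight_mul_or, bernoulliProb, bernoulliProb,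
    Finset.sum_mul_sum]
  refine Finset.sum_le_sum fun ω _ => Finset.sum_le_sum fun η _ => ?_
  rw [mul_mul_mul_comm]
  refine mul_le_mul_of_nonneg_left ?_
    (mul_nonneg (bernoulliWeight_nonneg hp ω) (bernoulliWeight_nonneg hq η))
  have hω : A ω → A fun c => ω c || η c := hA fun c => Bool.left_le_or _ _
  have hη : A η → A fun c => ω c || η c := hA fun c => Bool.right_le_or _ _
  by_cases h : A fun c => ω c || η c
  · simp only [h, not_true_eq_false, if_false]
    split_ifs <;> norm_num
  · simp [h, mt hω h, mt hη h]

lemma bernoulliProb_mono (hA : Monotone A) {p q : ℝ} (hp : 0 ≤ p) (hpq : p ≤ q) (hq : q ≤ 1) :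
    bernoulliProb p A ≤ bernoulliProb q A := by
  rcases hpq.eq_or_lt with rfl | hlt
  · rfl
  have hp' : p ∈ Set.Icc (0 : ℝ) 1 := ⟨hp, hpq.trans hq⟩
  have hpos : 0 < 1 - p := by linarith
  have hr : (q - p) / (1 - p) ∈ Set.Icc (0 : ℝ) 1 :=
    ⟨div_nonneg (by linarith) hpos.le, (div_le_one hpos).2 (by linarith)⟩
  have h := one_sub_bernoulliProb_union_le hA hp' hr
  have hq_eq : 1 - (1 - p) * (1 - (q - p) / (1 - p)) = q := by
    field_simp
    ring
  rw [hq_eq] at h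
  nlinarith [bernoulliProb_nonneg hr A, bernoulliProb_le_one hp' A]

lemma one_sub_bernoulliProb_le_pow (hA : Monotone A) {p : ℝ} (hp : p ∈ Set.Icc (0 : ℝ) 1)
    (m : ℕ) : 1 - bernoulliProb (1 - (1 - p) ^ m) A ≤ (1 - bernoulliProb p A) ^ m := by
  have hp' : 0 ≤ 1 - p := by linarith [hp.2]
  induction m with
  | zero => simpa using bernoulliProb_nonneg (p := 0) (by simp) A
  | succ m ih =>
    have hm : 1 - (1 - p) ^ m ∈ Set.Icc (0 : ℝ) 1 :=
      ⟨by linarith [pow_le_one₀ (n := m) hp' (by linarith [hp.1])],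
        by linarith [pow_nonneg hp' m]⟩
    have h := one_sub_bernoulliProb_union_le hA hm hp
    rw [sub_sub_cancel, ← pow_succ] at h
    rw [pow_succ]
    exact h.trans (mul_le_mul_of_nonneg_right ih (by linarith [bernoulliProb_le_one hp A]))

lemma one_sub_bernoulliProb_le_pow_of_mul_le (hA : Monotone A) {p q : ℝ} (hp : 0 ≤ p)
    (hp1 : p ≤ 1) (hq : q ≤ 1) {m : ℕ} (hpq : m * p ≤ q) :
    1 - bernoulliProb q A ≤ (1 - bernoulliProb p A) ^ m := by
  have hle : 1 - (1 - p) ^ m ≤ q := by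
    have := one_add_mul_le_pow (a := -p) (by linarith) m
    rw [← sub_eq_add_neg] at this
    linarith
  have h0 : 0 ≤ 1 - (1 - p) ^ m := by
    linarith [pow_le_one₀ (n := m) (by linarith : 0 ≤ 1 - p) (by linarith)]
  linarith [one_sub_bernoulliProb_le_pow hA ⟨hp, hp1⟩ m, bernoulliProb_mono hA h0 hle hq]

end BernoulliProduct

/-- A sequence of nontrivial monotone events in finite Bernoulli products has a threshold. -/
theorem exists_threshold_bernoulliProb {ι : ℕ → Type*} [∀ n, Fintype (ι n)]
    [∀ n, DecidableEq (ι n)] (A : ∀ n, (ι n → Bool) → Prop) (hA : ∀ n, Monotone (A n))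
    (hfalse : ∀ᶠ n in atTop, ¬ A n fun _ => false) (htrue : ∀ᶠ n in atTop, A n fun _ => true) :
    ∃ pstar : ℕ → ℝ, (∀ n, 0 < pstar n) ∧
      ∀ p : ℕ → ℝ, (∀ n, 0 ≤ p n ∧ p n ≤ 1) →
        (Tendsto (fun n => p n / pstar n) atTop (nhds 0) →
          Tendsto (fun n => bernoulliProb (p n) (A n)) atTop (nhds 0)) ∧
        (Tendsto (fun n => p n / pstar n) atTop atTop →
          Tendsto (fun n => bernoulliProb (p n) (A n)) atTop (nhds 1)) := by
  have hmid : ∀ n, ∃ q : ℝ, 0 < q ∧ ((¬ A n fun _ => false) → (A n fun _ => true) →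
      q ≤ 1 ∧ bernoulliProb q (A n) = 1 / 2) := by
    intro n
    by_cases h : (¬ A n fun _ => false) ∧ A n fun _ => true
    · have hivt := intermediate_value_Icc (zero_le_one (α := ℝ))
        (continuous_bernoulliProb (A n)).continuousOn
      rw [bernoulliProb_zero h.1, bernoulliProb_one h.2] at hivt
      obtain ⟨q, hq, hqhalf⟩ := hivt (show (1 / 2 : ℝ) ∈ Set.Icc 0 1 by norm_num)
      refine ⟨q, lt_of_le_of_ne hq.1 ?_, fun _ _ => ⟨hq.2, hqhalf⟩⟩
      rintro rfl
      norm_num [bernoulliProb_zero h.1] at hqhalf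
    · exact ⟨1, one_pos, fun h0 h1 => absurd ⟨h0, h1⟩ h⟩
  choose pstar hpos hhalf using hmid
  refine ⟨pstar, hpos, fun p hp => ⟨fun hlim => ?_, fun hlim => ?_⟩⟩
  · rw [Metric.tendsto_nhds]
    refine fun ε hε => ?_
    obtain ⟨m, hm⟩ : ∃ m : ℕ, (1 - min ε 1) ^ m < 1 / 2 :=
      exists_pow_lt_of_lt_one (by norm_num) (by linarith [lt_min hε one_pos])
    have hsmall := hlim.eventually (gt_mem_nhds (show (0 : ℝ) < 1 / (m + 1) by positivity))
    filter_upwards [hfalse, htrue, hsmall] with n h0 h1 h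
    obtain ⟨hq1, hq⟩ := hhalf n h0 h1
    have hle : m * p n ≤ pstar n := by
      rw [div_lt_div_iff₀ (hpos n) (by positivity)] at h
      nlinarith [(hp n).1]
    have hpow := one_sub_bernoulliProb_le_pow_of_mul_le (hA n) (hp n).1 (hp n).2 hq1 hle
    rw [Real.dist_eq, sub_zero, abs_of_nonneg (bernoulliProb_nonneg (hp n) _)]
    by_contra! hge
    have : (1 - bernoulliProb (p n) (A n)) ^ m ≤ (1 - min ε 1) ^ m :=
      pow_le_pow_left₀ (by linarith [bernoulliProb_le_one (hp n) (A n)])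
        (by linarith [min_le_left ε 1]) m
    linarith
  · rw [Metric.tendsto_nhds]
    refine fun ε hε => ?_
    obtain ⟨m, hm⟩ : ∃ m : ℕ, (1 / 2 : ℝ) ^ m < ε :=
      exists_pow_lt_of_lt_one hε (by norm_num)
    filter_upwards [hfalse, htrue, hlim.eventually_ge_atTop (m : ℝ)] with n h0 h1 h
    obtain ⟨hq1, hq⟩ := hhalf n h0 h1
    have hpow := one_sub_bernoulliProb_le_pow_of_mul_le (hA n) (hpos n).le hq1 (hp n).2
      ((le_div_iff₀ (hpos n)).1 h)
    rw [hq, show (1 - 1 / 2 : ℝ) = 1 / 2 by norm_num] at hpow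
    rw [dist_comm, Real.dist_eq,
      abs_of_nonneg (by linarith [bernoulliProb_le_one (hp n) (A n)])]
    linarith

lemma motifProb_eq_bernoulliProb {k n : ℕ} (H : SimpleGraph (Fin k)) (p : ℝ)
    (Q : SimpleGraph (Fin n) → Prop) [Fintype (Copy H n)] [DecidableEq (Copy H n)] :
    motifProb H n p Q = bernoulliProb p (fun ω : Copy H n → Bool => Q (graphOf ω)) := by
  unfold motifProb selProb bernoulliProb bernoulliWeight
  congr!

lemma graphOf_mono {k n : ℕ} {H : SimpleGraph (Fin k)} :
    Monotone (graphOf : (Copy H n → Bool) → SimpleGraph (Fin n)) := by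
  refine fun ω η h => iSup_mono fun c => ?_
  cases hω : ω c
  · simp
  · have hη : η c = true := Bool.eq_true_of_true_le (hω ▸ h c)
    simp [hη]

lemma graphOf_false {k n : ℕ} (H : SimpleGraph (Fin k)) :
    graphOf (fun _ : Copy H n => false) = ⊥ := by
  simp [graphOf]

lemma graphOf_true {k n : ℕ} {H : SimpleGraph (Fin k)} {a b : Fin k} (hab : H.Adj a b)
    (hkn : k ≤ n) : graphOf (fun _ : Copy H n => true) = ⊤ := by
  refine top_le_iff.1 fun u v huv => ?_
  let e := Fin.castLEEmb hkn
  let σ := Equiv.swap (e a) u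
  let τ := Equiv.swap (σ (e b)) v
  have hne : u ≠ σ (e b) := by
    rw [← Equiv.swap_apply_left (e a) u]
    exact σ.injective.ne (e.injective.ne hab.ne)
  let f : Fin k ↪ Fin n := e.trans (σ.trans τ).toEmbedding
  have hfa : f a = u := by
    change τ (σ (e a)) = u
    rw [Equiv.swap_apply_left]
    exact Equiv.swap_apply_of_ne_of_ne hne huv
  have hfb : f b = v := Equiv.swap_apply_left _ _
  let c : Copy H n := ⟨H.map f, f, rfl⟩
  have hle : H.map f ≤ graphOf (fun _ : Copy H n => true) :=
    (le_iSup (fun c : Copy H n => if true then c.1 else ⊥) c : _)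
  have hmap : (H.map f).Adj (f a) (f b) := SimpleGraph.map_adj_apply.2 hab
  rw [hfa, hfb] at hmap
  exact hle hmap

/-- **Theorem 1 (Bollobás–Thomason for random motif graphs).**  Every non-trivial
monotone increasing graph property has a threshold in `G(H,n,p)`: there is a
function `p* = p*(n) > 0` such that for any probability sequence `p(n)`, if
`p/p* → 0` then `Pr[G(H,n,p) ∈ P] → 0`, and if `p/p* → ∞` then
`Pr[G(H,n,p) ∈ P] → 1`. -/
theorem monotone_property_has_threshold {k : ℕ} (H : SimpleGraph (Fin k)) (hk : 0 < k)
    (hiso : ∀ v, (H.neighborSet v).Nonempty)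
    (P : ∀ n, SimpleGraph (Fin n) → Prop)
    (hmono : ∀ n, ∀ G G' : SimpleGraph (Fin n), G ≤ G' → P n G → P n G')
    (hinv : ∀ n, ∀ G G' : SimpleGraph (Fin n), Nonempty (G ≃g G') → (P n G ↔ P n G'))
    (hnontrivial : ∀ᶠ n in atTop, (∃ G : SimpleGraph (Fin n), P n G) ∧
      (∃ G : SimpleGraph (Fin n), ¬ P n G)) :
    ∃ pstar : ℕ → ℝ, (∀ n, 0 < pstar n) ∧
      ∀ p : ℕ → ℝ, (∀ n, 0 ≤ p n ∧ p n ≤ 1) →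
        (Tendsto (fun n => p n / pstar n) atTop (nhds 0) →
          Tendsto (fun n => motifProb H n (p n) (P n)) atTop (nhds 0)) ∧
        (Tendsto (fun n => p n / pstar n) atTop atTop →
          Tendsto (fun n => motifProb H n (p n) (P n)) atTop (nhds 1)) := by
  classical
  obtain ⟨b, hab⟩ := hiso ⟨0, hk⟩
  simp only [motifProb_eq_bernoulliProb]
  refine exists_threshold_bernoulliProb (fun n (ω : Copy H n → Bool) => P n (graphOf ω))
    (fun n ω η h => hmono n _ _ (graphOf_mono h)) ?_ ?_
  · filter_upwards [hnontrivial] with n ⟨_, G, hG⟩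
    rw [graphOf_false]
    exact fun h => hG (hmono n _ _ bot_le h)
  · filter_upwards [hnontrivial, eventually_ge_atTop k] with n ⟨⟨G, hG⟩, _⟩ hn
    rw [graphOf_true hab hn]
    exact hmono n _ _ le_top hG

end RandomMotif
end

section
/- Let H be a fixed graph. Then Pr[G(H,n,p) is connected] → 0 as n → ∞ if p ≤ p_1^-(H), and Pr[G(H,n,p) is connected] → 1 as n → ∞ if p ≥ p_1^+(H). -/
open Filter

namespace RandomMotif

/-! ### Events that avoid a given family of copies -/

section Weights

variable {k n : ℕ} {H : SimpleGraph (Fin k)}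

lemma prod_weight_nonneg {p : ℝ} (hp : 0 ≤ p ∧ p ≤ 1) (s : Finset (Copy H n))
    (ω : Copy H n → Bool) : 0 ≤ ∏ c ∈ s, if ω c then p else 1 - p := by
  refine Finset.prod_nonneg fun c _ => ?_
  split_ifs
  exacts [hp.1, sub_nonneg.2 hp.2]

open Classical in
lemma selProb_avoid (p : ℝ) (A : Finset (Copy H n)) :
    selProb H n p (fun ω => ∀ c ∈ A, ω c = false) = (1 - p) ^ A.card := by
  have key := Finset.prod_univ_sum (fun _ : Copy H n => (Finset.univ : Finset Bool))
    (fun c b => (if b then p else 1 - p) * (if c ∈ A → b = false then (1 : ℝ) else 0))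
  have hA : ∀ c : Copy H n, ∑ b : Bool,
      (if b then p else 1 - p) * (if c ∈ A → b = false then (1 : ℝ) else 0)
        = if c ∈ A then 1 - p else 1 := by
    intro c
    by_cases hc : c ∈ A <;> simp [hc]
  rw [Finset.prod_congr rfl fun c _ => hA c, Finset.prod_ite_mem] at key
  simp only [Finset.univ_inter, Finset.prod_const, Fintype.piFinset_univ] at key
  rw [key, selProb]
  refine Finset.sum_congr (by congr!) fun ω _ => ?_
  rw [Finset.prod_mul_distrib]
  congr 1
  by_cases h : ∀ c ∈ A, ω c = false
  · rw [if_pos h, Finset.prod_eq_one fun c _ => if_pos (h c)]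
  · rw [if_neg h]
    push Not at h
    obtain ⟨c, hc, hω⟩ := h
    exact (Finset.prod_eq_zero (Finset.mem_univ c) (if_neg fun h => hω (h hc))).symm

open Classical in
lemma sum_weight (p : ℝ) :
    ∑ ω : Copy H n → Bool, ∏ c : Copy H n, (if ω c then p else 1 - p) = 1 := by
  have h := selProb_avoid (H := H) p (∅ : Finset (Copy H n))
  simpa [selProb] using h

lemma selProb_mono {p : ℝ} (hp : 0 ≤ p ∧ p ≤ 1) {P Q : (Copy H n → Bool) → Prop}
    (h : ∀ ω, P ω → Q ω) : selProb H n p P ≤ selProb H n p Q := by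
  classical
  refine Finset.sum_le_sum fun ω _ =>
    mul_le_mul_of_nonneg_left ?_ (prod_weight_nonneg hp _ ω)
  by_cases hP : P ω
  · simp [hP, h ω hP]
  · rw [if_neg hP]
    split_ifs <;> norm_num

lemma selProb_nonneg {p : ℝ} (hp : 0 ≤ p ∧ p ≤ 1) (P : (Copy H n → Bool) → Prop) :
    0 ≤ selProb H n p P := by
  classical
  refine Finset.sum_nonneg fun ω _ => mul_nonneg (prod_weight_nonneg hp _ ω) ?_
  split_ifs <;> norm_num

lemma selProb_add_not (p : ℝ) (P : (Copy H n → Bool) → Prop) :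
    selProb H n p P + selProb H n p (fun ω => ¬ P ω) = 1 := by
  classical
  rw [← sum_weight (H := H) (n := n) p, selProb, selProb, ← Finset.sum_add_distrib]
  refine Finset.sum_congr (by congr!) fun ω _ => ?_
  by_cases hP : P ω <;> simp [hP]

lemma selProb_exists_le {ι : Type*} {p : ℝ} (hp : 0 ≤ p ∧ p ≤ 1) (s : Finset ι)
    (P : ι → (Copy H n → Bool) → Prop) :
    selProb H n p (fun ω => ∃ i ∈ s, P i ω) ≤ ∑ i ∈ s, selProb H n p (P i) := by
  classical
  unfold selProb
  rw [Finset.sum_comm]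
  refine Finset.sum_le_sum fun ω _ => ?_
  rw [← Finset.mul_sum]
  refine mul_le_mul_of_nonneg_left ?_ (prod_weight_nonneg hp _ ω)
  have h0 : ∀ i ∈ s, (0 : ℝ) ≤ if P i ω then 1 else 0 := fun i _ => by
    split_ifs <;> norm_num
  split_ifs with h
  · obtain ⟨i, hi, hP⟩ := h
    have := Finset.single_le_sum h0 hi
    rwa [if_pos hP] at this
  · exact Finset.sum_nonneg h0

/-- The second moment method: if the events `E i` have expected total `μ`, then the probability
that none of them occurs is at most the variance of the count divided by `μ ^ 2`. -/
lemma selProb_none_mul_sq_le {ι : Type*} {p : ℝ} (hp : 0 ≤ p ∧ p ≤ 1) (s : Finset ι)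
    (E : ι → (Copy H n → Bool) → Prop) :
    selProb H n p (fun ω => ∀ i ∈ s, ¬ E i ω) * (∑ i ∈ s, selProb H n p (E i)) ^ 2 ≤
      ∑ i ∈ s, ∑ j ∈ s, selProb H n p (fun ω => E i ω ∧ E j ω)
        - (∑ i ∈ s, selProb H n p (E i)) ^ 2 := by
  classical
  set μ := ∑ i ∈ s, selProb H n p (E i) with hμ
  let w : (Copy H n → Bool) → ℝ := fun ω => ∏ c : Copy H n, if ω c then p else 1 - p
  let X : (Copy H n → Bool) → ℝ := fun ω => ∑ i ∈ s, if E i ω then 1 else 0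
  have hX1 : ∑ ω, w ω * X ω = μ := by
    simp only [hμ, X, selProb, Finset.mul_sum, w]
    rw [Finset.sum_comm]
  have hX2 : ∑ ω, w ω * X ω ^ 2 =
      ∑ i ∈ s, ∑ j ∈ s, selProb H n p (fun ω => E i ω ∧ E j ω) := by
    have : ∀ ω, w ω * X ω ^ 2 =
        ∑ i ∈ s, ∑ j ∈ s, w ω * if E i ω ∧ E j ω then 1 else 0 := by
      intro ω
      rw [sq, Finset.sum_mul_sum, Finset.mul_sum]
      refine Finset.sum_congr rfl fun i _ => ?_
      rw [Finset.mul_sum]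
      refine Finset.sum_congr rfl fun j _ => ?_
      by_cases h1 : E i ω <;> by_cases h2 : E j ω <;> simp [h1, h2]
    rw [Finset.sum_congr rfl fun ω _ => this ω, Finset.sum_comm]
    refine Finset.sum_congr rfl fun i _ => ?_
    rw [Finset.sum_comm]
    refine Finset.sum_congr rfl fun j _ => ?_
    rw [selProb]
    congr!
  have hw : ∑ ω, w ω = 1 := by
    rw [← sum_weight (H := H) (n := n) p]
  have hvar : ∑ ω, w ω * (X ω - μ) ^ 2 =
      ∑ i ∈ s, ∑ j ∈ s, selProb H n p (fun ω => E i ω ∧ E j ω) - μ ^ 2 := by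
    have : ∀ ω, w ω * (X ω - μ) ^ 2 =
        w ω * X ω ^ 2 - 2 * μ * (w ω * X ω) + μ ^ 2 * w ω := fun ω => by ring
    rw [Finset.sum_congr rfl fun ω _ => this ω, Finset.sum_add_distrib, Finset.sum_sub_distrib,
      ← Finset.mul_sum, ← Finset.mul_sum, hX1, hX2, hw]
    ring
  rw [← hvar, selProb, Finset.sum_mul]
  refine Finset.sum_le_sum fun ω _ => ?_
  rw [mul_assoc]
  refine mul_le_mul_of_nonneg_left ?_ (prod_weight_nonneg hp _ ω)
  split_ifs with h
  · have : X ω = 0 := Finset.sum_eq_zero fun i hi => if_neg (h i hi)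
    rw [this, zero_sub, neg_sq, one_mul]
  · rw [zero_mul]; exact sq_nonneg _

end Weights

/-! ### Counting copies through prescribed vertices -/

section Counting

variable {k : ℕ} (H : SimpleGraph (Fin k)) (n : ℕ)

open Classical in
/-- The copies of `H` having the property `P`. -/
noncomputable def copiesWith (P : SimpleGraph (Fin n) → Prop) : Finset (Copy H n) :=
  Finset.univ.filter fun c => P c.1

/-- The copies of `H` whose vertex set contains `v`. -/
noncomputable abbrev through (v : Fin n) : Finset (Copy H n) :=
  copiesWith H n fun G => v ∈ G.support

/-- The copies of `H` whose vertex set contains both `u` and `v`. -/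
noncomputable abbrev throughBoth (u v : Fin n) : Finset (Copy H n) :=
  copiesWith H n fun G => u ∈ G.support ∧ v ∈ G.support

/-- The copies of `H` in which `u` and `v` are adjacent. -/
noncomputable abbrev joining (u v : Fin n) : Finset (Copy H n) :=
  copiesWith H n fun G => G.Adj u v

/-- The copies of `H` with an edge between `S` and its complement. -/
noncomputable abbrev crossing (S : Finset (Fin n)) : Finset (Copy H n) :=
  copiesWith H n fun G => ∃ u ∈ S, ∃ v ∉ S, G.Adj u v

variable {H n}

@[simp]
lemma mem_copiesWith {P : SimpleGraph (Fin n) → Prop} {c : Copy H n} :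
    c ∈ copiesWith H n P ↔ P c.1 := by
  simp [copiesWith]

lemma IsCopy.map {G : SimpleGraph (Fin n)} (h : IsCopy H G) (π : Equiv.Perm (Fin n)) :
    IsCopy H (G.map π) := by
  obtain ⟨f, rfl⟩ := h
  exact ⟨f.trans π.toEmbedding, by rw [SimpleGraph.map_map]; rfl⟩

lemma card_copiesWith_map (P : SimpleGraph (Fin n) → Prop) (π : Equiv.Perm (Fin n)) :
    (copiesWith H n fun G => P (G.map π)).card = (copiesWith H n P).card := by
  have hinv : ∀ (σ τ : Equiv.Perm (Fin n)) (G : SimpleGraph (Fin n)), σ * τ = 1 →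
      (G.map τ).map σ = G := by
    intro σ τ G h
    rw [SimpleGraph.map_map, ← Equiv.Perm.coe_mul, h, Equiv.Perm.coe_one, SimpleGraph.map_id]
  refine Finset.card_bij' (fun c _ => ⟨c.1.map π, c.2.map π⟩)
    (fun c _ => ⟨c.1.map (π⁻¹ : Equiv.Perm _), c.2.map π⁻¹⟩) ?_ ?_ ?_ ?_
  · intro c hc
    simpa using hc
  · intro c hc
    rw [mem_copiesWith] at hc ⊢
    rwa [hinv π π⁻¹ _ (mul_inv_cancel π)]
  · intro c _
    exact Subtype.ext (hinv _ _ _ (inv_mul_cancel π))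
  · intro c _
    exact Subtype.ext (hinv _ _ _ (mul_inv_cancel π))

lemma map_perm_adj (π : Equiv.Perm (Fin n)) (G : SimpleGraph (Fin n)) (u v : Fin n) :
    (G.map π).Adj (π u) (π v) ↔ G.Adj u v :=
  SimpleGraph.map_adj_apply (f := π.toEmbedding)

lemma mem_support_map_perm (π : Equiv.Perm (Fin n)) (G : SimpleGraph (Fin n)) (v : Fin n) :
    π v ∈ (G.map π).support ↔ v ∈ G.support := by
  have := SimpleGraph.support_map π.toEmbedding G
  simp only [Equiv.coe_toEmbedding] at this
  rw [this]
  simp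

lemma card_through_eq (u v : Fin n) : (through H n u).card = (through H n v).card := by
  obtain ⟨π, rfl⟩ : ∃ π : Equiv.Perm (Fin n), π u = v := ⟨_, Equiv.swap_apply_left u v⟩
  rw [through, through, ← card_copiesWith_map (fun G => π u ∈ G.support) π]
  simp only [mem_support_map_perm]

lemma exists_perm_pair {u v u' v' : Fin n} (h : u ≠ v) (h' : u' ≠ v') :
    ∃ π : Equiv.Perm (Fin n), π u = u' ∧ π v = v' := by
  have := Equiv.Perm.isMultiplyPretransitive (Fin n) 2
  exact MulAction.is_two_pretransitive_iff.1 this h h'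

lemma card_throughBoth_eq {u v u' v' : Fin n} (h : u ≠ v) (h' : u' ≠ v') :
    (throughBoth H n u v).card = (throughBoth H n u' v').card := by
  obtain ⟨π, rfl, rfl⟩ := exists_perm_pair h h'
  rw [throughBoth, throughBoth,
    ← card_copiesWith_map (fun G => π u ∈ G.support ∧ π v ∈ G.support) π]
  simp only [mem_support_map_perm]

lemma card_joining_eq {u v u' v' : Fin n} (h : u ≠ v) (h' : u' ≠ v') :
    (joining H n u v).card = (joining H n u' v').card := by
  obtain ⟨π, rfl, rfl⟩ := exists_perm_pair h h'
  rw [joining, joining, ← card_copiesWith_map (fun G => G.Adj (π u) (π v)) π]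
  simp only [map_perm_adj]

lemma mr_one_eq_card_through (v : Fin n) : mr H n 1 = (through H n v).card := by
  classical
  let z : Fin n := ⟨0, v.pos⟩
  have e : {G : SimpleGraph (Fin n) // IsCopy H G ∧ ∃ v ∈ G.support, (v : ℕ) < 1} ≃
      {c : Copy H n // c ∈ through H n z} :=
    (Equiv.subtypeSubtypeEquivSubtypeInter (IsCopy H)
      fun G : SimpleGraph (Fin n) => ∃ v ∈ G.support, (v : ℕ) < 1).symm.trans
    (Equiv.subtypeEquivRight fun c => by
      rw [mem_copiesWith]
      refine ⟨fun ⟨v, hv, h⟩ => ?_, fun h => ⟨z, h, Nat.zero_lt_one⟩⟩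
      rwa [show z = v from Fin.ext (Nat.lt_one_iff.1 h).symm])
  rw [card_through_eq v z, mr, Nat.card_congr e, Nat.card_eq_fintype_card, Fintype.card_coe]

lemma card_support_eq (hiso : ∀ v, (H.neighborSet v).Nonempty) (c : Copy H n)
    [DecidablePred fun v => v ∈ c.1.support] :
    (Finset.univ.filter fun v => v ∈ c.1.support).card = k := by
  obtain ⟨G, f, rfl⟩ := c
  have : (Finset.univ.filter fun v => v ∈ (H.map f).support) = Finset.univ.map f := by
    ext v
    simp only [Finset.mem_filter_univ, SimpleGraph.support_map, Finset.mem_map, Finset.mem_univ,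
      true_and, Set.mem_image]
    exact ⟨fun ⟨x, _, h⟩ => ⟨x, h⟩, fun ⟨x, h⟩ => ⟨x, hiso x, h⟩⟩
  simp only [this, Finset.card_map, Finset.card_univ, Fintype.card_fin]

open Classical in
lemma card_copiesWith (P : SimpleGraph (Fin n) → Prop) :
    (copiesWith H n P).card = ∑ c : Copy H n, if P c.1 then 1 else 0 :=
  Finset.card_filter _ _

open Classical in
lemma sum_card_copiesWith {ι : Type*} (s : Finset ι) (P : ι → SimpleGraph (Fin n) → Prop) :
    ∑ i ∈ s, (copiesWith H n (P i)).card =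
      ∑ c : Copy H n, (s.filter fun i => P i c.1).card := by
  simp only [copiesWith, Finset.card_filter]
  exact Finset.sum_comm

open Classical in
lemma sum_card_copiesWith_and {ι : Type*} (s : Finset ι) (Q : SimpleGraph (Fin n) → Prop)
    (P : ι → SimpleGraph (Fin n) → Prop) :
    ∑ i ∈ s, (copiesWith H n fun G => Q G ∧ P i G).card =
      ∑ c ∈ copiesWith H n Q, (s.filter fun i => P i c.1).card := by
  rw [sum_card_copiesWith, copiesWith, Finset.sum_filter]
  refine Finset.sum_congr rfl fun c _ => ?_
  by_cases h : Q c.1 <;> simp [h]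

lemma card_throughBoth_mul (hiso : ∀ v, (H.neighborSet v).Nonempty) {u v : Fin n} (h : u ≠ v) :
    (throughBoth H n u v).card * (n - 1) = (through H n u).card * (k - 1) := by
  classical
  have h1 := sum_card_copiesWith_and (H := H) (Finset.univ.erase u) (fun G => u ∈ G.support)
    (fun v G => v ∈ G.support)
  rw [Finset.sum_congr rfl fun w hw =>
      card_throughBoth_eq (Finset.ne_of_mem_erase hw).symm h,
    Finset.sum_const, Finset.card_erase_of_mem (Finset.mem_univ u), Finset.card_univ,
    Fintype.card_fin, smul_eq_mul, mul_comm] at h1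
  rw [h1, ← smul_eq_mul, ← Finset.sum_const]
  refine Finset.sum_congr rfl fun c hc => ?_
  rw [Finset.filter_erase, Finset.card_erase_of_mem (by simpa using hc)]
  congr 1
  convert card_support_eq hiso c

lemma card_through_le {u v : Fin n} (h : u ≠ v) :
    (through H n u).card ≤ (joining H n u v).card * (n - 1) := by
  classical
  have h1 := sum_card_copiesWith (H := H) (Finset.univ.erase u) (fun v G => G.Adj u v)
  rw [Finset.sum_congr rfl fun w hw =>
      card_joining_eq (Finset.ne_of_mem_erase hw).symm h,
    Finset.sum_const, Finset.card_erase_of_mem (Finset.mem_univ u), Finset.card_univ,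
    Fintype.card_fin, smul_eq_mul, mul_comm] at h1
  rw [h1, Finset.card_eq_sum_ones]
  refine le_trans (Finset.sum_le_sum fun c hc => ?_)
    (Finset.sum_le_sum_of_subset (Finset.subset_univ (through H n u)))
  obtain ⟨w, hw⟩ := mem_copiesWith.1 hc
  replace hw : c.1.Adj u w := hw
  exact Finset.card_pos.2 ⟨w, by simp [hw, hw.ne']⟩

lemma card_mul_through_le (S : Finset (Fin n)) :
    ∑ v ∈ S, (through H n v).card ≤
      (crossing H n S).card + ∑ e ∈ S.offDiag, (throughBoth H n e.1 e.2).card := by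
  classical
  rw [sum_card_copiesWith, sum_card_copiesWith, card_copiesWith,
    ← Finset.sum_add_distrib]
  refine Finset.sum_le_sum fun c _ => ?_
  let T := S.filter fun v => v ∈ c.1.support
  refine le_trans (Finset.card_le_card (t := T) fun v hv => by simpa [T] using hv)
    (le_trans ?_ (Nat.add_le_add_left (Finset.card_le_card (s := T.offDiag) fun e he => ?_) _))
  swap
  · simp only [T, Finset.mem_filter, Finset.mem_offDiag] at he ⊢
    tauto
  rw [Finset.offDiag_card]
  rcases lt_trichotomy T.card 1 with h | h | h
  · omega
  · obtain ⟨v, hv⟩ := Finset.card_eq_one.1 h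
    have hvT : v ∈ T := by simp [hv]
    obtain ⟨hvS, w, hw⟩ := Finset.mem_filter.1 hvT
    have hwS : w ∉ S := fun hwS => by
      have : w ∈ T := Finset.mem_filter.2 ⟨hwS, v, hw.symm⟩
      rw [hv, Finset.mem_singleton] at this
      exact hw.ne this.symm
    rw [if_pos ⟨v, hvS, w, hwS, hw⟩]
    omega
  · have := Nat.mul_le_mul_right T.card (show 2 ≤ T.card from h)
    omega

lemma sum_joining_le (hiso : ∀ v, (H.neighborSet v).Nonempty) (S : Finset (Fin n)) :
    ∑ e ∈ S ×ˢ Sᶜ, (joining H n e.1 e.2).card ≤ (crossing H n S).card * (k * k) := by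
  classical
  rw [sum_card_copiesWith, card_copiesWith, Finset.sum_mul]
  refine Finset.sum_le_sum fun c _ => ?_
  split_ifs with h
  · rw [one_mul]
    refine le_of_le_of_eq ?_ (congrArg (fun m => m * m) (card_support_eq hiso c))
    rw [← Finset.card_product]
    refine Finset.card_le_card fun e he => ?_
    have he := (Finset.mem_filter.1 he).2
    simp only [Finset.mem_product, Finset.mem_filter_univ]
    exact ⟨⟨_, he⟩, ⟨_, he.symm⟩⟩
  · rw [zero_mul, nonpos_iff_eq_zero, Finset.card_eq_zero, Finset.filter_eq_empty_iff]
    intro e he hadj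
    rw [Finset.mem_product, Finset.mem_compl] at he
    exact h ⟨_, he.1, _, he.2, hadj⟩

lemma two_le_of_neighborSet_nonempty (hk : 0 < k) (hiso : ∀ v, (H.neighborSet v).Nonempty) :
    2 ≤ k := by
  obtain ⟨w, hw⟩ := hiso ⟨0, hk⟩
  have := Fin.val_ne_of_ne hw.ne
  have := w.2
  simp only at *
  omega

lemma one_le_card_throughBoth (hk : 0 < k) (hiso : ∀ v, (H.neighborSet v).Nonempty)
    (hkn : k ≤ n) {u v : Fin n} (h : u ≠ v) : 1 ≤ (throughBoth H n u v).card := by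
  obtain ⟨w, hw⟩ := hiso ⟨0, hk⟩
  let f := Fin.castLEEmb hkn
  have hadj : (H.map f).Adj (f ⟨0, hk⟩) (f w) := SimpleGraph.map_adj_apply.2 hw
  rw [card_throughBoth_eq h hadj.ne]
  exact Finset.card_pos.2 ⟨⟨H.map f, f, rfl⟩, mem_copiesWith.2 ⟨⟨_, hadj⟩, ⟨_, hadj.symm⟩⟩⟩

end Counting

/-! ### Connectivity of the selected graph -/

section Connectivity

variable {k n : ℕ} {H : SimpleGraph (Fin k)}

lemma graphOf_adj {ω : Copy H n → Bool} {u v : Fin n} :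
    (graphOf ω).Adj u v ↔ ∃ c : Copy H n, ω c = true ∧ c.1.Adj u v := by
  rw [graphOf, SimpleGraph.iSup_adj]
  refine exists_congr fun c => ?_
  by_cases h : ω c = true <;> simp [h]

lemma not_connected_of_avoid_through (hn : 2 ≤ n) {ω : Copy H n → Bool} (v : Fin n)
    (h : ∀ c ∈ through H n v, ω c = false) : ¬ (graphOf ω).Connected := by
  intro hconn
  have : Nontrivial (Fin n) := Fin.nontrivial_iff_two_le.2 hn
  obtain ⟨w, hw⟩ := exists_ne v
  obtain ⟨walk⟩ := hconn.preconnected v w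
  cases walk with
  | nil => exact hw rfl
  | cons hadj _ =>
    obtain ⟨c, hc, hadj⟩ := graphOf_adj.1 hadj
    have := h c (mem_copiesWith.2 ⟨_, hadj⟩)
    simp [hc] at this

lemma crossing_compl (S : Finset (Fin n)) : crossing H n Sᶜ = crossing H n S := by
  ext c
  simp only [mem_copiesWith, Finset.mem_compl, not_not]
  constructor <;>
  · rintro ⟨u, hu, v, hv, h⟩
    exact ⟨v, hv, u, hu, h.symm⟩

lemma exists_avoid_crossing (hn : 0 < n) {ω : Copy H n → Bool} (h : ¬ (graphOf ω).Connected) :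
    ∃ S : Finset (Fin n), S.Nonempty ∧ 2 * S.card ≤ n ∧ ∀ c ∈ crossing H n S, ω c = false := by
  classical
  have : Nonempty (Fin n) := ⟨⟨0, hn⟩⟩
  obtain ⟨u, v, huv⟩ : ∃ u v, ¬ (graphOf ω).Reachable u v := by
    by_contra! hc
    exact h ⟨hc⟩
  let S : Finset (Fin n) := Finset.univ.filter fun w => (graphOf ω).Reachable u w
  have hS : ∀ c ∈ crossing H n S, ω c = false := by
    intro c hc
    obtain ⟨a, ha, b, hb, hab⟩ := mem_copiesWith.1 hc
    simp only [S, Finset.mem_filter_univ] at ha hb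
    by_contra hω
    have hadj : (graphOf ω).Adj a b := graphOf_adj.2 ⟨c, by simpa using hω, hab⟩
    exact hb (ha.trans hadj.reachable)
  have hcard := Finset.card_add_card_compl S
  rw [Fintype.card_fin] at hcard
  by_cases hle : 2 * S.card ≤ n
  · exact ⟨S, ⟨u, by simp [S]⟩, hle, hS⟩
  · exact ⟨Sᶜ, ⟨v, by simpa [S] using huv⟩, by omega, by rwa [crossing_compl]⟩

lemma mul_mr_le_card_crossing (hk : 0 < k) (hiso : ∀ v, (H.neighborSet v).Nonempty)
    {S : Finset (Fin n)} (hS : S.Nonempty) (hSn : 2 * S.card ≤ n) :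
    (S.card : ℝ) * mr H n 1 * (1 - k * S.card / n) ≤ (crossing H n S).card := by
  have hr := hS.card_pos
  obtain ⟨v, -⟩ := hS
  have : Nontrivial (Fin n) := Fin.nontrivial_iff_two_le.2 (by omega)
  obtain ⟨w, hw⟩ := exists_ne v
  have h1 := card_mul_through_le (H := H) S
  rw [Finset.sum_congr rfl fun u _ => (mr_one_eq_card_through (H := H) u).symm,
    Finset.sum_congr rfl fun e he =>
      card_throughBoth_eq (H := H) (Finset.mem_offDiag.1 he).2.2 hw,
    Finset.sum_const, Finset.sum_const, smul_eq_mul, smul_eq_mul, Finset.offDiag_card] at h1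
  have h2 := card_throughBoth_mul hiso hw
  rw [← mr_one_eq_card_through] at h2
  generalize (throughBoth H n w v).card = b at h1 h2
  generalize (crossing H n S).card = t at h1 ⊢
  generalize mr H n 1 = m at h1 h2 ⊢
  generalize S.card = r at *
  have hn1 : (0 : ℝ) < n - 1 := by
    have : (2 : ℝ) ≤ n := by exact_mod_cast (by omega : 2 ≤ n)
    linarith
  have hn0 : (0 : ℝ) < n := by linarith
  have hr1 : (1 : ℝ) ≤ r := by exact_mod_cast hr
  have hrn : (r : ℝ) ≤ n := by exact_mod_cast (by omega : r ≤ n)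
  have h1' : (r : ℝ) * m ≤ t + (r * r - r) * b := by
    have : r ≤ r * r := Nat.le_mul_self r
    have h1 : ((r * m : ℕ) : ℝ) ≤ ((t + (r * r - r) * b : ℕ) : ℝ) := by exact_mod_cast h1
    push_cast [Nat.cast_sub this] at h1
    exact h1
  have h2' : (b : ℝ) * (n - 1) = m * (k - 1) := by
    have h2 : ((b * (n - 1) : ℕ) : ℝ) = ((m * (k - 1) : ℕ) : ℝ) := by exact_mod_cast h2
    rw [Nat.cast_mul, Nat.cast_mul, Nat.cast_pred (by omega), Nat.cast_pred hk] at h2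
    exact h2
  have hb : (b : ℝ) = m * (k - 1) / (n - 1) := by field_simp; linarith
  have hm : (0 : ℝ) ≤ m := Nat.cast_nonneg m
  have hfrac : (r * r - r) * (b : ℝ) ≤ r * m * (k * r / n) := by
    have e1 : (r * r - r) * (b : ℝ) = (r * m) * ((k - 1) * ((r - 1) / (n - 1))) := by
      rw [hb]; ring
    have e2 : ((r : ℝ) - 1) / (n - 1) ≤ r / n := by
      rw [div_le_div_iff₀ hn1 hn0]; nlinarith
    have e3 : (0 : ℝ) ≤ (r - 1) / (n - 1) := div_nonneg (by linarith) hn1.le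
    rw [e1, mul_div_assoc]
    have hk0 : (0 : ℝ) ≤ k := Nat.cast_nonneg k
    refine mul_le_mul_of_nonneg_left ?_ (by positivity)
    nlinarith [mul_le_mul_of_nonneg_left e2 hk0]
  linarith

lemma mr_div_le_card_crossing (hk : 0 < k) (hiso : ∀ v, (H.neighborSet v).Nonempty)
    {S : Finset (Fin n)} (hS : S.Nonempty) (hSn : 2 * S.card ≤ n) :
    (S.card : ℝ) * mr H n 1 * (1 / (2 * k ^ 2)) ≤ (crossing H n S).card := by
  have hr := hS.card_pos
  obtain ⟨v, -⟩ := hS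
  have : Nontrivial (Fin n) := Fin.nontrivial_iff_two_le.2 (by omega)
  obtain ⟨w, hw⟩ := exists_ne v
  have h1 := sum_joining_le hiso S
  rw [Finset.sum_congr rfl fun e he => card_joining_eq (H := H) (fun h =>
      (Finset.mem_compl.1 (Finset.mem_product.1 he).2) (h ▸ (Finset.mem_product.1 he).1)) hw,
    Finset.sum_const, smul_eq_mul, Finset.card_product, Finset.card_compl,
    Fintype.card_fin] at h1
  have h2 := card_through_le (H := H) hw
  rw [← mr_one_eq_card_through] at h2
  generalize (joining H n w v).card = d at h1 h2
  generalize (crossing H n S).card = t at h1 ⊢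
  generalize mr H n 1 = m at h1 h2 ⊢
  generalize S.card = r at *
  have h3 : r * m ≤ 2 * (t * (k * k)) := calc
    r * m ≤ r * (d * (n - 1)) := Nat.mul_le_mul_left _ h2
    _ ≤ r * (d * (2 * (n - r))) :=
      Nat.mul_le_mul_left _ (Nat.mul_le_mul_left _ (by omega))
    _ = 2 * (r * (n - r) * d) := by ring
    _ ≤ _ := Nat.mul_le_mul_left _ h1
  have h3' : (r : ℝ) * m ≤ 2 * (t * (k * k)) := by exact_mod_cast h3
  have hk' : (0 : ℝ) < k := by exact_mod_cast hk
  rw [mul_one_div, div_le_iff₀ (by positivity)]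
  linarith

end Connectivity

/-! ### Above the threshold -/

section Above

lemma choose_le_exp {n r : ℕ} (hr : 1 ≤ r) (hn : 1 ≤ n) :
    (n.choose r : ℝ) ≤ Real.exp (r * (1 + Real.log n - Real.log r)) := by
  have hr0 : (0 : ℝ) < r := by exact_mod_cast hr
  have hn0 : (0 : ℝ) < n := by exact_mod_cast hn
  have h1 := Real.pow_div_factorial_le_exp (r : ℝ) hr0.le r
  have h2 : (n.choose r : ℝ) ≤ (n : ℝ) ^ r / r.factorial := Nat.choose_le_pow_div r n
  have h3 : Real.exp (r * (1 + Real.log n - Real.log r)) = (n / r : ℝ) ^ r * Real.exp r := by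
    rw [add_sub_assoc, mul_add, mul_one, Real.exp_add, ← Real.log_div hn0.ne' hr0.ne',
      mul_comm, Real.exp_nat_mul, Real.exp_log (by positivity)]
  calc (n.choose r : ℝ) ≤ (n : ℝ) ^ r / r.factorial := h2
    _ = (n / r : ℝ) ^ r * ((r : ℝ) ^ r / r.factorial) := by
      rw [div_pow]; field_simp
    _ ≤ _ := by rw [h3]; gcongr

/-- A lower bound, relative to `r * mr H n 1`, for the number of copies with an edge leaving a
given set of `r` vertices. -/
noncomputable def crossingRatio (k n r : ℕ) : ℝ :=
  max ((1 : ℝ) / (2 * (k : ℝ) ^ 2)) (1 - (k : ℝ) * r / n)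

lemma exponent_le {k r n : ℕ} (hk : 0 < k) (hr : 1 ≤ r) (hrn : r ≤ n) {x Y : ℝ} (hY : 0 ≤ Y)
    (hx : 2 * (Y + 1 + 2 * k) ≤ x) (hn : 2 * k ≤ √(n : ℝ)) (hlog : 4 * (Y + 1) ≤ Real.log n)
    (hlog' : (Y + 1 + Real.log (4 * k)) * (2 * k ^ 2) ≤ Real.log n) :
    1 + Real.log n - Real.log r
      - (Real.log n + x) * crossingRatio k n r ≤ -Y := by
  have hk0 : (0 : ℝ) < k := by exact_mod_cast hk
  have hr1 : (1 : ℝ) ≤ r := by exact_mod_cast hr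
  have hn0 : (0 : ℝ) < n := by exact_mod_cast (by omega : 0 < n)
  have hs0 : 0 < √(n : ℝ) := Real.sqrt_pos.2 hn0
  have hss : √(n : ℝ) * √(n : ℝ) = n := Real.mul_self_sqrt hn0.le
  have hL : Real.log n = 2 * Real.log √(n : ℝ) := by rw [Real.log_sqrt hn0.le]; ring
  have hx0 : 0 ≤ x := by nlinarith
  have hL0 : 0 ≤ Real.log n := by linarith
  have hr0 : 0 ≤ Real.log r := Real.log_nonneg hr1
  rw [crossingRatio]
  have hmax1 := mul_le_mul_of_nonneg_left
    (le_max_right ((1 : ℝ) / (2 * (k : ℝ) ^ 2)) (1 - (k : ℝ) * r / n)) (add_nonneg hL0 hx0)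
  have hmax2 := mul_le_mul_of_nonneg_left
    (le_max_left ((1 : ℝ) / (2 * (k : ℝ) ^ 2)) (1 - (k : ℝ) * r / n)) (add_nonneg hL0 hx0)
  by_cases h1 : (r : ℝ) ≤ √n
  · have e1 : (k * r / n : ℝ) ≤ 1 / 2 := by
      rw [div_le_iff₀ hn0]; nlinarith
    have e2 : Real.log n * (k * r / n : ℝ) ≤ 2 * k := by
      have hls : Real.log n ≤ 2 * √n := by
        have := Real.log_le_self hs0.le
        linarith
      have : Real.log n * r ≤ 2 * √n * √n := mul_le_mul hls h1 (by positivity) (by positivity)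
      rw [← mul_div_assoc, div_le_iff₀ hn0]
      nlinarith
    nlinarith
  by_cases h2 : (4 * k * r : ℝ) ≤ n
  · push Not at h1
    have e1 : (k * r / n : ℝ) ≤ 1 / 4 := by
      rw [div_le_iff₀ hn0]; linarith
    have e2 : Real.log √n ≤ Real.log r := Real.log_le_log hs0 h1.le
    nlinarith
  · push Not at h2
    have e1 : Real.log n ≤ Real.log (4 * k) + Real.log r := by
      rw [← Real.log_mul (by positivity) (by positivity)]
      exact Real.log_le_log hn0 h2.le
    have e2 : Y + 1 + Real.log (4 * k) ≤ Real.log n * (1 / (2 * k ^ 2)) := by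
      rw [mul_one_div, le_div_iff₀ (by positivity)]
      exact hlog'
    have e3 : 0 ≤ x * (1 / (2 * (k : ℝ) ^ 2)) := by positivity
    nlinarith

lemma sum_range_pow_succ_le {q : ℝ} (h0 : 0 ≤ q) (h1 : q ≤ 1 / 2) (n : ℕ) :
    ∑ r ∈ Finset.range n, q ^ (r + 1) ≤ 2 * q := by
  have h := geom_sum_mul_neg q n
  have hs : 0 ≤ ∑ i ∈ Finset.range n, q ^ i := Finset.sum_nonneg fun i _ => pow_nonneg h0 i
  have hq : 0 ≤ q ^ n := pow_nonneg h0 n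
  simp only [pow_succ]
  rw [← Finset.sum_mul]
  nlinarith

variable {k n : ℕ} {H : SimpleGraph (Fin k)}

lemma one_sub_pow_card_crossing_le (hk : 0 < k) (hiso : ∀ v, (H.neighborSet v).Nonempty)
    {p b : ℝ} (hp : 0 ≤ p ∧ p ≤ 1) (hb : b ≤ p * mr H n 1)
    {S : Finset (Fin n)} (hS : S.Nonempty) (hSn : 2 * S.card ≤ n) :
    (1 - p) ^ (crossing H n S).card ≤
      Real.exp (-(S.card * (b * crossingRatio k n S.card))) := by
  have h1 : (S.card : ℝ) * mr H n 1 * crossingRatio k n S.card ≤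
      (crossing H n S).card := by
    rw [crossingRatio]
    rcases max_choice ((1 : ℝ) / (2 * (k : ℝ) ^ 2)) (1 - (k : ℝ) * S.card / n) with h | h <;> rw [h]
    · exact mr_div_le_card_crossing hk hiso hS hSn
    · exact mul_mr_le_card_crossing hk hiso hS hSn
  have hρ : (0 : ℝ) ≤ crossingRatio k n S.card :=
    le_max_of_le_left (by positivity)
  generalize crossingRatio k n S.card = ρ at *
  have h2 : 1 - p ≤ Real.exp (-p) := by linarith [Real.add_one_le_exp (-p)]
  refine (pow_le_pow_left₀ (sub_nonneg.2 hp.2) h2 _).trans ?_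
  rw [← Real.exp_nat_mul]
  refine Real.exp_le_exp.2 ?_
  have h3 := mul_le_mul_of_nonneg_left h1 hp.1
  have h4 := mul_le_mul_of_nonneg_left hb
    (mul_nonneg (Nat.cast_nonneg (α := ℝ) S.card) hρ)
  linarith

lemma selProb_not_connected_le (hk : 0 < k) (hiso : ∀ v, (H.neighborSet v).Nonempty)
    (hn : 0 < n) {p x Y : ℝ} (hp : 0 ≤ p ∧ p ≤ 1) (hpx : Real.log n + x ≤ p * mr H n 1)
    (hY : 0 ≤ Y) (hY' : Real.exp (-Y) ≤ 1 / 2)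
    (hx : 2 * (Y + 1 + 2 * k) ≤ x) (hsqrt : 2 * k ≤ √(n : ℝ))
    (hlog : 4 * (Y + 1) ≤ Real.log n)
    (hlog' : (Y + 1 + Real.log (4 * k)) * (2 * k ^ 2) ≤ Real.log n) :
    selProb H n p (fun ω => ¬ (graphOf ω).Connected) ≤ 2 * Real.exp (-Y) := by
  classical
  let g : ℕ → ℝ := fun r => if 1 ≤ r ∧ 2 * r ≤ n then
    Real.exp (-(r * ((Real.log n + x) * crossingRatio k n r))) else 0
  let F : Finset (Finset (Fin n)) := Finset.univ.filter fun S => 1 ≤ S.card ∧ 2 * S.card ≤ n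
  calc selProb H n p (fun ω => ¬ (graphOf ω).Connected)
      ≤ selProb H n p (fun ω => ∃ S ∈ F, ∀ c ∈ crossing H n S, ω c = false) := by
        refine selProb_mono hp fun ω hω => ?_
        obtain ⟨S, h1, h2, h3⟩ := exists_avoid_crossing hn hω
        exact ⟨S, by simpa [F, h2] using h1, h3⟩
    _ ≤ ∑ S ∈ F, selProb H n p (fun ω => ∀ c ∈ crossing H n S, ω c = false) :=
        selProb_exists_le hp _ _
    _ ≤ ∑ S ∈ F, g S.card := by
        refine Finset.sum_le_sum fun S hS => ?_
        have hS := (Finset.mem_filter.1 hS).2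
        simp only [g]
        rw [selProb_avoid, if_pos hS]
        exact one_sub_pow_card_crossing_le hk hiso hp hpx (Finset.card_pos.1 hS.1) hS.2
    _ ≤ ∑ S ∈ (Finset.univ : Finset (Fin n)).powerset, g S.card := by
        refine Finset.sum_le_sum_of_subset_of_nonneg (fun S _ => by simp) fun S _ _ => ?_
        simp only [g]
        split_ifs <;> positivity
    _ = ∑ r ∈ Finset.range (n + 1), n.choose r • g r := by
        rw [Finset.sum_powerset_apply_card, Finset.card_univ, Fintype.card_fin]
    _ = ∑ r ∈ Finset.range n, n.choose (r + 1) • g (r + 1) := by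
        rw [Finset.sum_range_succ']
        simp [g]
    _ ≤ ∑ r ∈ Finset.range n, Real.exp (-Y) ^ (r + 1) := by
        refine Finset.sum_le_sum fun r hr => ?_
        rw [nsmul_eq_mul]
        simp only [g]
        split_ifs with h
        · refine (mul_le_mul_of_nonneg_right (choose_le_exp h.1 hn) (Real.exp_nonneg _)).trans ?_
          rw [← Real.exp_add, ← Real.exp_nat_mul, ← sub_eq_add_neg, ← mul_sub]
          refine Real.exp_le_exp.2 (mul_le_mul_of_nonneg_left ?_ (Nat.cast_nonneg _))
          exact exponent_le hk h.1 (by omega) hY hx hsqrt hlog hlog'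
        · rw [mul_zero]; positivity
    _ ≤ 2 * Real.exp (-Y) := sum_range_pow_succ_le (Real.exp_nonneg _) hY' n

lemma sub_one_le_mul_mr (hk : 0 < k) (hiso : ∀ v, (H.neighborSet v).Nonempty) (hkn : k ≤ n) :
    (n : ℝ) - 1 ≤ k * mr H n 1 := by
  have h2 := two_le_of_neighborSet_nonempty hk hiso
  have : Nontrivial (Fin n) := Fin.nontrivial_iff_two_le.2 (h2.trans hkn)
  obtain ⟨v, w, hvw⟩ := exists_pair_ne (Fin n)
  have h := card_throughBoth_mul hiso hvw
  rw [← mr_one_eq_card_through] at h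
  have h1 : n - 1 ≤ k * mr H n 1 := calc
    n - 1 ≤ (throughBoth H n v w).card * (n - 1) :=
      Nat.le_mul_of_pos_left _ (one_le_card_throughBoth hk hiso hkn hvw)
    _ = mr H n 1 * (k - 1) := h
    _ ≤ k * mr H n 1 := by rw [mul_comm]; exact Nat.mul_le_mul_right _ (Nat.sub_le _ _)
  have h1 : ((n - 1 : ℕ) : ℝ) ≤ ((k * mr H n 1 : ℕ) : ℝ) := by exact_mod_cast h1
  rwa [Nat.cast_pred (by omega), Nat.cast_mul] at h1

lemma deltad_one (hk : 0 < k) (hiso : ∀ v, (H.neighborSet v).Nonempty) : deltad H 1 = 0 := by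
  have : Nonempty (Fin k) := ⟨⟨0, hk⟩⟩
  obtain ⟨v, hv⟩ := ciInf_mem fun v => (H.neighborSet v).ncard
  have hpos : 1 ≤ minDeg H := by
    rw [minDeg, ← hv]
    exact (Set.ncard_pos (Set.toFinite _)).2 (hiso v)
  have : (1 : ℝ) / minDeg H ≤ 1 := by
    rw [div_le_one (by exact_mod_cast hpos)]
    exact_mod_cast hpos
  have : ⌈((1 : ℕ) : ℝ) / (minDeg H : ℝ)⌉₊ ≤ 1 := Nat.ceil_le.2 (by simpa using this)
  rw [deltad]
  omega

end Above

/-! ### Below the threshold -/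

section Below

variable {k n : ℕ} {H : SimpleGraph (Fin k)}

lemma exp_neg_le_one_sub {p : ℝ} (h1 : p ≤ 1 / 2) :
    Real.exp (-(p + 2 * p ^ 2)) ≤ 1 - p := by
  have h := Real.add_one_le_exp (p + 2 * p ^ 2)
  rw [Real.exp_neg]
  refine inv_le_of_inv_le₀ (by linarith) (le_trans ?_ h)
  rw [inv_le_iff_one_le_mul₀ (by linarith)]
  nlinarith [mul_nonneg (sq_nonneg p) (by linarith : (0 : ℝ) ≤ 1 - 2 * p)]

lemma one_sub_pow_card_union_le {p : ℝ} (hp' : p < 1) {b : ℕ}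
    (hb : ∀ u v : Fin n, u ≠ v → (throughBoth H n u v).card = b) (u v : Fin n)
    [DecidableEq (Copy H n)] :
    (1 - p) ^ (through H n u ∪ through H n v).card ≤
      (if u = v then (1 - p) ^ mr H n 1 else 0) +
        ((1 - p) ^ mr H n 1) ^ 2 * ((1 - p) ^ b)⁻¹ := by
  have hq : 0 < 1 - p := by linarith
  split_ifs with h
  · subst h
    rw [Finset.union_self, ← mr_one_eq_card_through]
    exact le_add_of_nonneg_right (by positivity)
  · rw [zero_add, le_mul_inv_iff₀ (by positivity), ← pow_add, ← pow_mul]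
    have hinter : through H n u ∩ through H n v = throughBoth H n u v := by
      ext c; simp only [Finset.mem_inter, mem_copiesWith]
    have hc := Finset.card_union_add_card_inter (through H n u) (through H n v)
    rw [hinter, hb u v h, ← mr_one_eq_card_through, ← mr_one_eq_card_through] at hc
    rw [hc, mul_two]

lemma selProb_connected_le (hn : 2 ≤ n) {p : ℝ} (hp : 0 ≤ p) (hp' : p < 1) {b : ℕ}
    (hb : ∀ u v : Fin n, u ≠ v → (throughBoth H n u v).card = b) :
    selProb H n p (fun ω => (graphOf ω).Connected) ≤
      (n * (1 - p) ^ mr H n 1)⁻¹ + ((1 - p) ^ b)⁻¹ - 1 := by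
  classical
  have hpp : 0 ≤ p ∧ p ≤ 1 := ⟨hp, hp'.le⟩
  have hq : 0 < 1 - p := by linarith
  have hn0 : (0 : ℝ) < n := by exact_mod_cast (by omega : 0 < n)
  have h1 := selProb_none_mul_sq_le (H := H) hpp (Finset.univ : Finset (Fin n))
    (fun v ω => ∀ c ∈ through H n v, ω c = false)
  have hμ : ∑ v : Fin n, selProb H n p (fun ω => ∀ c ∈ through H n v, ω c = false) =
      n * (1 - p) ^ mr H n 1 := by
    simp only [selProb_avoid, ← mr_one_eq_card_through, Finset.sum_const, Finset.card_univ,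
      Fintype.card_fin, nsmul_eq_mul]
  have h2 : ∑ u : Fin n, ∑ v : Fin n, selProb H n p (fun ω =>
      (∀ c ∈ through H n u, ω c = false) ∧ ∀ c ∈ through H n v, ω c = false) ≤
      n * (1 - p) ^ mr H n 1 + n ^ 2 * (((1 - p) ^ mr H n 1) ^ 2 * ((1 - p) ^ b)⁻¹) := by
    simp only [← Finset.forall_mem_union, selProb_avoid]
    refine (Finset.sum_le_sum fun u _ => Finset.sum_le_sum fun v _ =>
      one_sub_pow_card_union_le hp' hb u v).trans (le_of_eq ?_)
    simp only [Finset.sum_add_distrib, Finset.sum_ite_eq, Finset.mem_univ, if_true,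
      Finset.sum_const, Finset.card_univ, Fintype.card_fin, nsmul_eq_mul]
    ring
  have h3 : selProb H n p (fun ω => (graphOf ω).Connected) ≤ selProb H n p
      (fun ω => ∀ v ∈ (Finset.univ : Finset (Fin n)),
        ¬ ∀ c ∈ through H n v, ω c = false) :=
    selProb_mono hpp fun ω hω v _ hv => not_connected_of_avoid_through hn v hv hω
  refine h3.trans ?_
  rw [hμ] at h1
  have hQ : 0 < (1 - p) ^ mr H n 1 := by positivity
  have ht : 0 < (1 - p) ^ b := by positivity
  generalize (1 - p) ^ mr H n 1 = Q at *
  have h4 := (le_div_iff₀ (by positivity)).2 (h1.trans (sub_le_sub_right h2 _))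
  refine h4.trans (le_of_eq ?_)
  field_simp

lemma selProb_connected_le_exp (hk : 0 < k) (hiso : ∀ v, (H.neighborSet v).Nonempty)
    (hkn : k ≤ n) {p x : ℝ} (hp : 0 ≤ p) (hx : 0 ≤ x)
    (hpx : p * mr H n 1 ≤ Real.log n - x) (hlog : 4 * k * (Real.log n / n) ≤ 1) :
    selProb H n p (fun ω => (graphOf ω).Connected) ≤
      Real.exp (-x + 4 * k * (Real.log n ^ 2 / n))
        + Real.exp (4 * k * (Real.log n / n)) - 1 := by
  have hk2 := two_le_of_neighborSet_nonempty hk hiso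
  have hn2 := hk2.trans hkn
  have : Nontrivial (Fin n) := Fin.nontrivial_iff_two_le.2 hn2
  obtain ⟨v, w, hvw⟩ := exists_pair_ne (Fin n)
  have hm := sub_one_le_mul_mr hk hiso hkn
  have hb := card_throughBoth_mul hiso hvw
  rw [← mr_one_eq_card_through] at hb
  have hb' : ∀ u' v' : Fin n, u' ≠ v' →
      (throughBoth H n u' v').card = (throughBoth H n v w).card :=
    fun u' v' h => card_throughBoth_eq h hvw
  generalize (throughBoth H n v w).card = b at hb hb'
  have hk0 : (0 : ℝ) < k := by exact_mod_cast hk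
  have hn2' : (2 : ℝ) ≤ n := by exact_mod_cast hn2
  have hn0 : (0 : ℝ) < n := by linarith
  have hL0 : 0 ≤ Real.log n := Real.log_nonneg (by linarith)
  have hbm : (b : ℝ) * (n - 1) ≤ k * mr H n 1 := by
    have h : b * (n - 1) ≤ k * mr H n 1 := by
      rw [hb, mul_comm]; exact Nat.mul_le_mul_right _ (Nat.sub_le _ _)
    have h : ((b * (n - 1) : ℕ) : ℝ) ≤ ((k * mr H n 1 : ℕ) : ℝ) := by exact_mod_cast h
    rwa [Nat.cast_mul, Nat.cast_pred (by omega), Nat.cast_mul] at h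
  have hm0 : (0 : ℝ) ≤ mr H n 1 := Nat.cast_nonneg _
  have hb0 : (0 : ℝ) ≤ b := Nat.cast_nonneg _
  have hpm : p * mr H n 1 ≤ Real.log n := by linarith
  have hpn : p ≤ 2 * k * (Real.log n / n) := by
    rw [← mul_div_assoc, le_div_iff₀ hn0]
    nlinarith
  have hbp : b * p ≤ 2 * k * (Real.log n / n) := by
    rw [← mul_div_assoc, le_div_iff₀ hn0]
    nlinarith [mul_le_mul_of_nonneg_right hbm hp, mul_nonneg hb0 hp]
  have hp2 : p ≤ 1 / 2 := by linarith
  refine (selProb_connected_le hn2 hp (by linarith) hb').trans ?_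
  have hexp := exp_neg_le_one_sub hp2
  have key : ∀ j : ℕ, ((1 - p) ^ j)⁻¹ ≤ Real.exp (j * (p + 2 * p ^ 2)) := by
    intro j
    rw [← neg_neg (j * (p + 2 * p ^ 2)), Real.exp_neg, ← mul_neg, Real.exp_nat_mul]
    gcongr
  refine sub_le_sub_right (add_le_add ?_ ?_) _
  · rw [mul_inv]
    refine (mul_le_mul_of_nonneg_left (key _) (by positivity)).trans ?_
    nth_rewrite 1 [← Real.exp_log hn0]
    rw [← Real.exp_neg, ← Real.exp_add]
    refine Real.exp_le_exp.2 ?_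
    have : p * (p * mr H n 1) ≤ 2 * k * (Real.log n / n) * Real.log n :=
      mul_le_mul hpn hpm (by positivity) (by positivity)
    have e : Real.log n / n * Real.log n = Real.log n ^ 2 / n := by ring
    nlinarith
  · refine (key _).trans (Real.exp_le_exp.2 ?_)
    nlinarith [mul_nonneg (mul_nonneg hb0 hp) (by linarith : 0 ≤ 1 - 2 * p)]

end Below

/-- **Theorem 2 (connectivity threshold).**  If `p ≤ p_1^-(H)` then `G(H,n,p)` is
w.h.p. disconnected, and if `p ≥ p_1^+(H)` then `G(H,n,p)` is w.h.p. connected. -/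
theorem connectivity_threshold {k : ℕ} (H : SimpleGraph (Fin k)) (hk : 0 < k)
    (hiso : ∀ v, (H.neighborSet v).Nonempty)
    (x : ℕ → ℝ) (hx : Tendsto x atTop atTop)
    (hx' : Tendsto (fun n => x n / Real.log (Real.log n)) atTop (nhds 0))
    (p : ℕ → ℝ) (hp : ∀ n, 0 ≤ p n ∧ p n ≤ 1) :
    ((∀ᶠ n in atTop, p n ≤ pMinus H 1 x n) →
      Tendsto (fun n => motifProb H n (p n) (fun G => G.Connected)) atTop (nhds 0)) ∧
    ((∀ᶠ n in atTop, pPlus H 1 x n ≤ p n) →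
      Tendsto (fun n => motifProb H n (p n) (fun G => G.Connected)) atTop (nhds 1)) := by
  have hcast : Tendsto (fun n : ℕ => (n : ℝ)) atTop atTop := tendsto_natCast_atTop_atTop
  have hlog : Tendsto (fun n : ℕ => Real.log n) atTop atTop :=
    Real.tendsto_log_atTop.comp hcast
  have hk2 := two_le_of_neighborSet_nonempty hk hiso
  have hmr : ∀ᶠ n in atTop, (0 : ℝ) < mr H n 1 := by
    filter_upwards [eventually_ge_atTop k] with n hn
    have h1 := sub_one_le_mul_mr hk hiso hn
    have h2 : (2 : ℝ) ≤ n := by exact_mod_cast hk2.trans hn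
    exact pos_of_mul_pos_right (by linarith : (0 : ℝ) < k * mr H n 1) (Nat.cast_nonneg k)
  constructor
  · intro hle
    have hdiv : ∀ j : ℕ, Tendsto (fun n : ℕ => Real.log n ^ j / n) atTop (nhds 0) := fun j =>
      (Real.isLittleO_pow_log_id_atTop (n := j)).tendsto_div_nhds_zero.comp hcast
    have h1 : Tendsto (fun n : ℕ => 4 * k * (Real.log n / n)) atTop (nhds 0) := by
      simpa using (hdiv 1).const_mul (4 * (k : ℝ))
    have h2 : Tendsto (fun n : ℕ => 4 * k * (Real.log n ^ 2 / n)) atTop (nhds 0) := by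
      simpa using (hdiv 2).const_mul (4 * (k : ℝ))
    have h3 : Tendsto (fun n : ℕ => Real.exp (-x n + 4 * k * (Real.log n ^ 2 / n))
        + Real.exp (4 * k * (Real.log n / n)) - 1) atTop (nhds 0) := by
      have e1 := Real.tendsto_exp_atBot.comp ((tendsto_neg_atTop_atBot.comp hx).atBot_add h2)
      have e2 := (Real.continuous_exp.tendsto 0).comp h1
      simpa [Function.comp_def] using (e1.add e2).sub_const 1
    refine tendsto_of_tendsto_of_tendsto_of_le_of_le' tendsto_const_nhds h3
      (Eventually.of_forall fun n => selProb_nonneg (hp n) _) ?_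
    filter_upwards [hle, hmr, hx.eventually_ge_atTop 0, eventually_ge_atTop k,
      h1.eventually_le_const zero_lt_one] with n hpn hm hxn hkn hL
    refine selProb_connected_le_exp hk hiso hkn (hp n).1 hxn ?_ hL
    rw [pMinus, deltad_one hk hiso, le_div_iff₀ hm] at hpn
    simpa using hpn
  · intro hge
    have hnot : Tendsto (fun n => selProb H n (p n) fun ω => ¬ (graphOf ω).Connected) atTop
        (nhds 0) := by
      refine tendsto_order.2 ⟨fun a ha => Eventually.of_forall fun n =>
        ha.trans_le (selProb_nonneg (hp n) _), fun ε hε => ?_⟩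
      have hexp : Tendsto (fun Y : ℝ => Real.exp (-Y)) atTop (nhds 0) :=
        Real.tendsto_exp_atBot.comp tendsto_neg_atTop_atBot
      obtain ⟨Y, hY, hY1, hY2⟩ := ((eventually_ge_atTop (0 : ℝ)).and
        ((hexp.eventually_le_const (by norm_num : (0 : ℝ) < 1 / 2)).and
          (hexp.eventually_lt_const (half_pos hε)))).exists
      filter_upwards [hge, hmr, eventually_gt_atTop 0,
        hx.eventually_ge_atTop (2 * (Y + 1 + 2 * k)),
        (Real.tendsto_sqrt_atTop.comp hcast).eventually_ge_atTop (2 * k),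
        hlog.eventually_ge_atTop (4 * (Y + 1)),
        hlog.eventually_ge_atTop ((Y + 1 + Real.log (4 * k)) * (2 * k ^ 2))]
        with n hpn hm hn hxn hsqrt hL hL'
      rw [pPlus, deltad_one hk hiso, div_le_iff₀ hm] at hpn
      have := selProb_not_connected_le hk hiso hn (hp n) (by simpa using hpn) hY hY1 hxn
        hsqrt hL hL'
      linarith
    have heq : ∀ n, motifProb H n (p n) (fun G => G.Connected) =
        1 - selProb H n (p n) fun ω => ¬ (graphOf ω).Connected := fun n =>
      eq_sub_of_add_eq (selProb_add_not (p n) _)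
    simp only [heq]
    simpa using hnot.const_sub 1

end RandomMotif
end
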